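/- Let G be a weak near-triangulation and let D ⊆ X ⊆ V(G) be sets such that (i) G−X is a weak near-triangulation, (ii) D ⊆ N[y] for some y ∈ D, and (iii) D contains at least one external vertex of G. Then G−D is a weak near-triangulation if and only if every vertex of X∖D is contained in a triangle of G−D. -/

import Mathlib

open Set

/-- A plane graph: a finite simple graph whose vertices are points of the plane,
together with a plane embedding in which every edge is drawn as an arc (the range of an
injective path) joining its endpoints, two arcs meet only in common endpoints, and
no vertex lies on an arc other than at its endpoints. -/
structure PlaneGraph where
  verts : Set (ℝ × ℝ)
  finite_verts : verts.Finite
  Adj : (ℝ × ℝ) → (ℝ × ℝ) → Prop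
  adj_symm : ∀ u v, Adj u v → Adj v u
  adj_irrefl : ∀ v, ¬ Adj v v
  adj_mem : ∀ u v, Adj u v → u ∈ verts
  arc : (ℝ × ℝ) → (ℝ × ℝ) → Set (ℝ × ℝ)
  arc_symm : ∀ u v, arc u v = arc v u
  arc_path : ∀ u v, Adj u v → ∃ γ : Path u v, Function.Injective ⇑γ ∧ arc u v = Set.range ⇑γ
  arc_verts : ∀ u v, Adj u v → verts ∩ arc u v ⊆ {u, v}
  arc_inter : ∀ u v u' v', Adj u v → Adj u' v' → ({u, v} : Set (ℝ × ℝ)) ≠ {u', v'} →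
    arc u v ∩ arc u' v' ⊆ ({u, v} : Set (ℝ × ℝ)) ∩ {u', v'}

namespace PlaneGraph

/-- The plane subgraph induced on a set of vertices, with the inherited embedding. -/
def induce (G : PlaneGraph) (S : Set (ℝ × ℝ)) : PlaneGraph where
  verts := G.verts ∩ S
  finite_verts := G.finite_verts.subset inter_subset_left
  Adj u v := G.Adj u v ∧ u ∈ S ∧ v ∈ S
  adj_symm _ _ h := ⟨G.adj_symm _ _ h.1, h.2.2, h.2.1⟩
  adj_irrefl v h := G.adj_irrefl v h.1
  adj_mem _ _ h := ⟨G.adj_mem _ _ h.1, h.2.1⟩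
  arc := G.arc
  arc_symm := G.arc_symm
  arc_path _ _ h := G.arc_path _ _ h.1
  arc_verts _ _ h := fun _ hx => G.arc_verts _ _ h.1 ⟨hx.1.1, hx.2⟩
  arc_inter _ _ _ _ h h' hne := G.arc_inter _ _ _ _ h.1 h'.1 hne

/-- Deleting a set of vertices (together with all incident edges),
keeping the inherited embedding. -/
def delete (G : PlaneGraph) (X : Set (ℝ × ℝ)) : PlaneGraph := G.induce Xᶜ

/-- Deleting a single vertex. -/
def erase (G : PlaneGraph) (x : ℝ × ℝ) : PlaneGraph := G.delete {x}

/-- The point set of the plane drawing of `G`. -/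
def drawing (G : PlaneGraph) : Set (ℝ × ℝ) :=
  G.verts ∪ ⋃ (u) (v) (_ : G.Adj u v), G.arc u v

/-- The faces of `G`: connected components of the complement of the drawing. -/
def IsFace (G : PlaneGraph) (F : Set (ℝ × ℝ)) : Prop :=
  ∃ x, x ∉ G.drawing ∧ F = connectedComponentIn G.drawingᶜ x

/-- A vertex is external if it is incident to (i.e. lies on the boundary of)
an unbounded face. -/
def ExternalVertex (G : PlaneGraph) (v : ℝ × ℝ) : Prop :=
  v ∈ G.verts ∧ ∃ F, G.IsFace F ∧ ¬ Bornology.IsBounded F ∧ v ∈ closure F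

/-- A triangle (cycle on three vertices) of `G`. -/
def IsTriangle (G : PlaneGraph) (a b c : ℝ × ℝ) : Prop :=
  a ≠ b ∧ a ≠ c ∧ b ≠ c ∧ G.Adj a b ∧ G.Adj b c ∧ G.Adj a c

/-- `v` is contained in a triangle of `G`. -/
def InTriangle (G : PlaneGraph) (v : ℝ × ℝ) : Prop := ∃ b c, G.IsTriangle v b c

/-- The drawing of the closed curve formed by a triangle on `a`, `b`, `c`. -/
def triDrawing (G : PlaneGraph) (a b c : ℝ × ℝ) : Set (ℝ × ℝ) :=
  G.arc a b ∪ G.arc b c ∪ G.arc a c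

/-- A face is triangular if its boundary is the drawing of a triangle of `G`. -/
def IsTriangularFace (G : PlaneGraph) (F : Set (ℝ × ℝ)) : Prop :=
  ∃ a b c, G.IsTriangle a b c ∧ frontier F = G.triDrawing a b c

/-- The interior region of the closed curve drawn by a triangle: the union of the
bounded connected components of the complement of its drawing. -/
def triangleInterior (G : PlaneGraph) (a b c : ℝ × ℝ) : Set (ℝ × ℝ) :=
  {x | x ∉ G.triDrawing a b c ∧
    Bornology.IsBounded (connectedComponentIn (G.triDrawing a b c)ᶜ x)}

/-- A facial triangle: a triangle whose interior region is a face of `G`. -/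
def IsFacialTriangle (G : PlaneGraph) (a b c : ℝ × ℝ) : Prop :=
  G.IsTriangle a b c ∧ G.IsFace (G.triangleInterior a b c)

/-- A weak near-triangulation: every bounded face is triangular and every vertex
is contained in a triangle. -/
def IsWNT (G : PlaneGraph) : Prop :=
  (∀ F, G.IsFace F → Bornology.IsBounded F → G.IsTriangularFace F) ∧
  ∀ v ∈ G.verts, G.InTriangle v

/-- Reachability by walks in `G`. -/
def Reachable (G : PlaneGraph) (u v : ℝ × ℝ) : Prop := Relation.ReflTransGen G.Adj u v

/-- Connectedness of `G`. -/
def Connected (G : PlaneGraph) : Prop :=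
  G.verts.Nonempty ∧ ∀ u ∈ G.verts, ∀ v ∈ G.verts, G.Reachable u v

/-- A cutvertex: a vertex whose deletion separates two other vertices. -/
def IsCutvertex (G : PlaneGraph) (v : ℝ × ℝ) : Prop :=
  v ∈ G.verts ∧ ∃ a b, a ∈ G.verts ∧ b ∈ G.verts ∧ a ≠ v ∧ b ≠ v ∧
    G.Reachable a b ∧ ¬ (G.erase v).Reachable a b

/-- 2-connectivity: connected, on at least three vertices, with no cutvertex. -/
def TwoConnected (G : PlaneGraph) : Prop :=
  G.Connected ∧ 3 ≤ G.verts.ncard ∧ ∀ v, ¬ G.IsCutvertex v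

/-- A near-triangulation: a 2-connected plane graph all of whose bounded faces
are triangular. -/
def IsNearTriangulation (G : PlaneGraph) : Prop :=
  G.TwoConnected ∧ ∀ F, G.IsFace F → Bornology.IsBounded F → G.IsTriangularFace F

/-- A plane triangulation: a connected plane graph all of whose faces (including
the unbounded one) are triangular. -/
def IsTriangulation (G : PlaneGraph) : Prop :=
  G.Connected ∧ ∀ F, G.IsFace F → G.IsTriangularFace F

/-- A block of `G`, given by its vertex set `B`: a maximal set of vertices inducing
a connected subgraph without a cutvertex. -/
def IsBlock (G : PlaneGraph) (B : Set (ℝ × ℝ)) : Prop :=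
  B ⊆ G.verts ∧ (G.induce B).Connected ∧ (∀ v, ¬ (G.induce B).IsCutvertex v) ∧
  ∀ B', B ⊆ B' → B' ⊆ G.verts → (G.induce B').Connected →
    (∀ v, ¬ (G.induce B').IsCutvertex v) → B' = B

/-- A plane graph is outerplanar if all of its vertices are incident to the
unbounded face. -/
def IsOuterplanar (G : PlaneGraph) : Prop := ∀ v ∈ G.verts, G.ExternalVertex v

/-- A dominating set of `G`. -/
def IsDominatingSet (G : PlaneGraph) (D : Set (ℝ × ℝ)) : Prop :=
  D ⊆ G.verts ∧ ∀ v ∈ G.verts, v ∉ D → ∃ d ∈ D, G.Adj v d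

/-- The domination number of `G`. -/
noncomputable def dominationNumber (G : PlaneGraph) : ℕ :=
  sInf {n | ∃ D, G.IsDominatingSet D ∧ D.ncard = n}

/-- `u` is problematic in `G` if `G − u` is not a weak near-triangulation. -/
def Problematic (G : PlaneGraph) (u : ℝ × ℝ) : Prop := ¬ (G.erase u).IsWNT

/-- `x` is a `u`-bad vertex in `G`: a vertex of `G − u` not contained in a triangle
of `G − u`. -/
def IsBadFor (G : PlaneGraph) (u x : ℝ × ℝ) : Prop :=
  x ∈ G.verts ∧ x ≠ u ∧ ¬ (G.erase u).InTriangle x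

end PlaneGraph

namespace PlaneGraph

variable {G : PlaneGraph} {D : Set (ℝ × ℝ)}

lemma adj_mem_right {u v : ℝ × ℝ} (h : G.Adj u v) : v ∈ G.verts :=
  G.adj_mem v u (G.adj_symm u v h)

lemma left_mem_arc {u v : ℝ × ℝ} (h : G.Adj u v) : u ∈ G.arc u v := by
  obtain ⟨γ, -, h'⟩ := G.arc_path u v h
  exact h' ▸ ⟨0, γ.source⟩

lemma isPreconnected_arc {u v : ℝ × ℝ} (h : G.Adj u v) : IsPreconnected (G.arc u v) := by
  obtain ⟨γ, -, h'⟩ := G.arc_path u v h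
  exact h' ▸ isPreconnected_range γ.continuous

lemma isPreconnected_arc_diff_right {u v : ℝ × ℝ} (h : G.Adj u v) :
    IsPreconnected (G.arc u v \ {v}) := by
  obtain ⟨γ, hγ, h'⟩ := G.arc_path u v h
  have : G.arc u v \ {v} = γ '' Iio 1 := by
    ext p
    rw [h']
    constructor
    · rintro ⟨⟨t, rfl⟩, ht⟩
      refine ⟨t, lt_of_le_of_ne unitInterval.le_one' ?_, rfl⟩
      rintro rfl
      exact ht γ.target
    · rintro ⟨t, ht, rfl⟩
      exact ⟨⟨t, rfl⟩, fun e => (ne_of_lt ht) (hγ (e.trans γ.target.symm))⟩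
  rw [this]
  exact isPreconnected_Iio.image _ γ.continuous.continuousOn

lemma isClosed_drawing (G : PlaneGraph) : IsClosed G.drawing := by
  have key : (⋃ (u) (v) (_ : G.Adj u v), G.arc u v) =
      ⋃ p ∈ {p ∈ G.verts ×ˢ G.verts | G.Adj p.1 p.2}, G.arc p.1 p.2 := by
    ext x
    simp only [mem_iUnion, exists_prop]
    constructor
    · rintro ⟨u, v, h, hx⟩
      exact ⟨(u, v), ⟨⟨G.adj_mem _ _ h, adj_mem_right h⟩, h⟩, hx⟩
    · rintro ⟨⟨u, v⟩, ⟨-, h⟩, hx⟩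
      exact ⟨u, v, h, hx⟩
  rw [drawing, key]
  refine G.finite_verts.isClosed.union (Set.Finite.isClosed_biUnion
    ((G.finite_verts.prod G.finite_verts).subset (sep_subset _ _)) ?_)
  rintro ⟨u, v⟩ ⟨-, h⟩
  obtain ⟨γ, -, h'⟩ := G.arc_path u v h
  exact h' ▸ (isCompact_range γ.continuous).isClosed

lemma mem_drawing {p : ℝ × ℝ} :
    p ∈ G.drawing ↔ p ∈ G.verts ∨ ∃ u v, G.Adj u v ∧ p ∈ G.arc u v := by
  simp [drawing]

lemma drawing_delete_subset (G : PlaneGraph) (D : Set (ℝ × ℝ)) :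
    (G.delete D).drawing ⊆ G.drawing := by
  intro p hp
  rw [mem_drawing] at hp ⊢
  rcases hp with hp | ⟨u, v, h, hp⟩
  · exact Or.inl hp.1
  · exact Or.inr ⟨u, v, h.1, hp⟩

lemma notMem_drawing_delete {d : ℝ × ℝ} (hd : d ∈ D) (hv : d ∈ G.verts) :
    d ∉ (G.delete D).drawing := by
  rw [mem_drawing]
  rintro (h | ⟨u, v, h, hp⟩)
  · exact h.2 hd
  · rcases G.arc_verts u v h.1 ⟨hv, hp⟩ with rfl | rfl
    · exact h.2.1 hd
    · exact h.2.2 hd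

/-- An arc with an endpoint in `D` meets the drawing of `G - D` at most in the other endpoint. -/
lemma arc_diff_subset_compl_drawing_delete {u v : ℝ × ℝ} (h : G.Adj u v) (hu : u ∈ D) :
    G.arc u v \ {v} ⊆ (G.delete D).drawingᶜ := by
  rintro p ⟨hp, hpv⟩ hp'
  have hpu : p ≠ u := by
    rintro rfl
    exact notMem_drawing_delete hu (G.adj_mem _ _ h) hp'
  rcases mem_drawing.1 hp' with hp' | ⟨a, b, hab, hp'⟩
  · rcases G.arc_verts u v h ⟨hp'.1, hp⟩ with e | e
    · exact hpu e
    · exact hpv e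
  · have hne : ({u, v} : Set (ℝ × ℝ)) ≠ {a, b} := by
      intro e
      have : u ∈ ({a, b} : Set (ℝ × ℝ)) := e ▸ mem_insert u _
      rcases this with rfl | rfl
      · exact hab.2.1 hu
      · exact hab.2.2 hu
    rcases (G.arc_inter u v a b h hab.1 hne ⟨hp, hp'⟩).1 with e | e
    · exact hpu e
    · exact hpv e

lemma arc_subset_compl_drawing_delete {u v : ℝ × ℝ} (h : G.Adj u v) (hu : u ∈ D) (hv : v ∈ D) :
    G.arc u v ⊆ (G.delete D).drawingᶜ := by
  intro p hp
  by_cases e : p = v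
  · exact e ▸ notMem_drawing_delete hv (adj_mem_right h)
  · exact arc_diff_subset_compl_drawing_delete h hu ⟨hp, e⟩

lemma isPreconnected_of_isFace {F : Set (ℝ × ℝ)} (hF : G.IsFace F) : IsPreconnected F := by
  obtain ⟨x, -, rfl⟩ := hF
  exact isPreconnected_connectedComponentIn

lemma subset_compl_drawing_of_isFace {F : Set (ℝ × ℝ)} (hF : G.IsFace F) : F ⊆ G.drawingᶜ := by
  obtain ⟨x, -, rfl⟩ := hF
  exact connectedComponentIn_subset _ _

lemma eq_connectedComponentIn_of_isFace {F : Set (ℝ × ℝ)} (hF : G.IsFace F) {p : ℝ × ℝ}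
    (hp : p ∈ F) : F = connectedComponentIn G.drawingᶜ p := by
  obtain ⟨x, -, rfl⟩ := hF
  exact connectedComponentIn_eq hp

/-- A preconnected set avoiding the drawing and meeting a face lies in that face. -/
lemma subset_of_isFace {F S : Set (ℝ × ℝ)} (hF : G.IsFace F) (hS : IsPreconnected S)
    (hSG : S ⊆ G.drawingᶜ) {p : ℝ × ℝ} (hpS : p ∈ S) (hpF : p ∈ F) : S ⊆ F :=
  eq_connectedComponentIn_of_isFace hF hpF ▸ hS.subset_connectedComponentIn hpS hSG

/-- A point of the closure of a face that is not on the drawing lies in the face. -/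
lemma mem_of_mem_closure_isFace {F : Set (ℝ × ℝ)} (hF : G.IsFace F) {p : ℝ × ℝ}
    (hp : p ∈ closure F) (hpG : p ∉ G.drawing) : p ∈ F := by
  have hopen : IsOpen (connectedComponentIn G.drawingᶜ p) :=
    G.isClosed_drawing.isOpen_compl.connectedComponentIn
  have hmem : p ∈ connectedComponentIn G.drawingᶜ p := mem_connectedComponentIn hpG
  obtain ⟨q, hq, hqF⟩ := mem_closure_iff.1 hp _ hopen hmem
  rw [eq_connectedComponentIn_of_isFace hF hqF, ← connectedComponentIn_eq hq]
  exact hmem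

/-- If `D` lies in the closed neighborhood of one of its vertices and contains an external vertex,
then no bounded face of `G - D` contains a vertex of `D`. -/
lemma notMem_of_isFace_delete (hD : D ⊆ G.verts) (h2 : ∃ y ∈ D, ∀ d ∈ D, d = y ∨ G.Adj y d)
    (h3 : ∃ v ∈ D, G.ExternalVertex v) {F : Set (ℝ × ℝ)} (hF : (G.delete D).IsFace F)
    (hb : Bornology.IsBounded F) {d : ℝ × ℝ} (hd : d ∈ D) : d ∉ F := by
  intro hdF
  obtain ⟨y, hy, hyD⟩ := h2
  obtain ⟨v, hv, hvG, E, hE, hEb, hvE⟩ := h3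
  have hyF : y ∈ F := by
    rcases hyD d hd with rfl | h
    · exact hdF
    · have h' := G.adj_symm _ _ h
      exact subset_of_isFace hF (isPreconnected_arc h) (arc_subset_compl_drawing_delete h hy hd)
        (G.arc_symm d y ▸ left_mem_arc h') hdF (left_mem_arc h)
  have hvF : v ∈ F := by
    rcases hyD v hv with rfl | h
    · exact hyF
    · have h' := G.adj_symm _ _ h
      exact subset_of_isFace hF (isPreconnected_arc h) (arc_subset_compl_drawing_delete h hy hv)
        (left_mem_arc h) hyF (G.arc_symm v y ▸ left_mem_arc h')
  refine hEb (hb.subset ((subset_insert v E).trans (subset_of_isFace hF ?_ ?_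
    (mem_insert v E) hvF)))
  · exact (isPreconnected_of_isFace hE).subset_closure (subset_insert v E)
      (insert_subset hvE subset_closure)
  · exact insert_subset (notMem_drawing_delete hv (hD hv))
      ((subset_compl_drawing_of_isFace hE).trans
        (compl_subset_compl.2 (G.drawing_delete_subset D)))

/-- A face of `G - D` containing no vertex of `D` is a face of `G`. -/
lemma isFace_of_isFace_delete {F : Set (ℝ × ℝ)} (hF : (G.delete D).IsFace F)
    (hFD : ∀ d ∈ D, d ∉ F) : G.IsFace F := by
  have arc_disjoint : ∀ u v, G.Adj u v → u ∈ D → ∀ p ∈ G.arc u v, p ∉ F := by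
    intro u v h hu p hp hpF
    have hpv : p ≠ v ∨ v ∈ D := by
      by_contra! hc
      obtain ⟨rfl, hvD⟩ := hc
      exact subset_compl_drawing_of_isFace hF hpF (mem_drawing.2 (.inl ⟨adj_mem_right h, hvD⟩))
    by_cases e : p = v
    · exact hFD p (e ▸ hpv.resolve_left (not_not.2 e)) hpF
    · refine hFD u hu (subset_of_isFace hF (isPreconnected_arc_diff_right h)
        (arc_diff_subset_compl_drawing_delete h hu) ⟨hp, e⟩ hpF ⟨left_mem_arc h, ?_⟩)
      rintro rfl
      exact G.adj_irrefl _ h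
  have hFG : F ⊆ G.drawingᶜ := by
    intro p hpF hpG
    have hp' := subset_compl_drawing_of_isFace hF hpF
    rcases mem_drawing.1 hpG with hp | ⟨u, v, h, hp⟩
    · exact hp' (mem_drawing.2 (.inl ⟨hp, fun hpD => hFD p hpD hpF⟩))
    · by_cases hu : u ∈ D
      · exact arc_disjoint u v h hu p hp hpF
      by_cases hv : v ∈ D
      · exact arc_disjoint v u (G.adj_symm _ _ h) hv p (G.arc_symm u v ▸ hp) hpF
      exact hp' (mem_drawing.2 (.inr ⟨u, v, ⟨h, hu, hv⟩, hp⟩))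
  have hconn := isPreconnected_of_isFace hF
  obtain ⟨x, hx, hxF⟩ := hF
  have hxmem : x ∈ F := hxF ▸ mem_connectedComponentIn hx
  refine ⟨x, hFG hxmem, (hconn.subset_connectedComponentIn hxmem hFG).antisymm ?_⟩
  rw [hxF]
  exact connectedComponentIn_mono x (compl_subset_compl.2 (G.drawing_delete_subset D))

lemma InTriangle.delete_mono {X : Set (ℝ × ℝ)} (hDX : D ⊆ X) {v : ℝ × ℝ}
    (h : (G.delete X).InTriangle v) : (G.delete D).InTriangle v := by
  have hc := compl_subset_compl.2 hDX
  obtain ⟨b, c, hab, hac, hbc, h1, h2, h3⟩ := h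
  exact ⟨b, c, hab, hac, hbc, ⟨h1.1, hc h1.2.1, hc h1.2.2⟩, ⟨h2.1, hc h2.2.1, hc h2.2.2⟩,
    ⟨h3.1, hc h3.2.1, hc h3.2.2⟩⟩

/-- A face of `G - D` that contains no vertex of `D` and is triangular in `G` is triangular in
`G - D`. -/
lemma IsTriangularFace.delete (hD : D ⊆ G.verts) {F : Set (ℝ × ℝ)} (hF : (G.delete D).IsFace F)
    (hFD : ∀ d ∈ D, d ∉ F) (h : G.IsTriangularFace F) : (G.delete D).IsTriangularFace F := by
  obtain ⟨a, b, c, ⟨hab, hac, hbc, h1, h2, h3⟩, hfr⟩ := h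
  have key : ∀ p ∈ G.triDrawing a b c, p ∉ D := fun p hp hpD =>
    hFD p hpD (mem_of_mem_closure_isFace hF (frontier_subset_closure (hfr ▸ hp))
      (notMem_drawing_delete hpD (hD hpD)))
  have ha : a ∉ D := key a (.inl (.inl (left_mem_arc h1)))
  have hb : b ∉ D := key b (.inl (.inr (left_mem_arc h2)))
  have hc : c ∉ D := key c (.inr (G.arc_symm c a ▸ left_mem_arc (G.adj_symm _ _ h3)))
  exact ⟨a, b, c, ⟨hab, hac, hbc, ⟨h1, ha, hb⟩, ⟨h2, hb, hc⟩, ⟨h3, ha, hc⟩⟩, hfr⟩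

end PlaneGraph

open PlaneGraph in
/-- Let `G` be a weak near-triangulation and `D ⊆ X ⊆ V(G)` with (i) `G − X` a weak
near-triangulation, (ii) `D ⊆ N[y]` for some `y ∈ D`, (iii) `D` containing an
external vertex of `G`. Then `G − D` is a weak near-triangulation if and only if
every vertex of `X ∖ D` is contained in a triangle of `G − D`. -/
theorem WNT_delete_iff (G : PlaneGraph) (hG : G.IsWNT)
    (D X : Set (ℝ × ℝ)) (hDX : D ⊆ X) (hX : X ⊆ G.verts)
    (h1 : (G.delete X).IsWNT)
    (h2 : ∃ y ∈ D, ∀ d ∈ D, d = y ∨ G.Adj y d)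
    (h3 : ∃ v ∈ D, G.ExternalVertex v) :
    (G.delete D).IsWNT ↔ ∀ x ∈ X \ D, (G.delete D).InTriangle x := by
  refine ⟨fun h x hx => h.2 x ⟨hX hx.1, hx.2⟩, fun h => ⟨fun F hF hb => ?_, fun v hv => ?_⟩⟩
  · have hFD : ∀ d ∈ D, d ∉ F := fun d hd =>
      notMem_of_isFace_delete (hDX.trans hX) h2 h3 hF hb hd
    exact (hG.1 F (isFace_of_isFace_delete hF hFD) hb).delete (hDX.trans hX) hF hFD
  · by_cases hvX : v ∈ X
    · exact h v ⟨hvX, hv.2⟩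
    · exact (h1.2 v ⟨hv.1, hvX⟩).delete_mono hDX
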